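/- Assume the Riemann hypothesis. For real x > 1 define Q(x) = Σ_{m > √x} Λ(m)/(m² log m) + (2/(x log x)) Σ_{m ≤ √x} Λ(m). Then for all real x ≥ 81 one has Q(x) ≤ (0.249 + 2/log x)/√x. -/

import Mathlib

open ArithmeticFunction Finset

/-- The summand `Λ(m)/(m² log m)`. -/
noncomputable def qa (m : ℕ) : ℝ := vonMangoldt m / ((m : ℝ) ^ 2 * Real.log m)

/-- Partial sums of `qa`. -/
noncomputable def qP (n : ℕ) : ℝ := ∑ m ∈ range (n + 1), qa m

lemma qa_nonneg (m : ℕ) : 0 ≤ qa m := by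
  unfold qa
  apply div_nonneg vonMangoldt_nonneg
  apply mul_nonneg (by positivity) (Real.log_natCast_nonneg m)

lemma qa_prime_pow {p k : ℕ} (hp : p.Prime) (hk : k ≠ 0) :
    qa (p ^ k) = ((1 : ℝ) / (p : ℝ) ^ 2) ^ k / k := by
  unfold qa
  rw [vonMangoldt_apply_pow hk, vonMangoldt_apply_prime hp]
  have : 0 < Real.log p := Real.log_pos (by exact_mod_cast hp.one_lt)
  have hp0 : (0 : ℝ) < p := by exact_mod_cast hp.pos
  have hk0 : (0 : ℝ) < k := by exact_mod_cast Nat.pos_of_ne_zero hk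
  push_cast
  rw [Real.log_pow, one_div, inv_pow, ← pow_mul, ← pow_mul, mul_comm k 2]
  field_simp

/-- `n ↦ 1/n²` as a monoid-with-zero homomorphism. -/
noncomputable def qf : ℕ →*₀ ℝ where
  toFun n := 1 / (n : ℝ) ^ 2
  map_zero' := by simp
  map_one' := by simp
  map_mul' a b := by push_cast; field_simp

lemma prime_sq_lt {p : ℕ} (hp : p.Prime) : (1 : ℝ) / (p : ℝ) ^ 2 < 1 := by
  have : (1 : ℝ) < p := by exact_mod_cast hp.one_lt
  rw [div_lt_one (by positivity)]
  nlinarith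

lemma prod_le (N : ℕ) :
    ∏ p ∈ Nat.primesBelow N, (1 - (1 : ℝ) / (p : ℝ) ^ 2)⁻¹ ≤ Real.pi ^ 2 / 6 := by
  have hs : Summable (fun n => ‖qf n‖) := by
    have := hasSum_zeta_two.summable
    refine this.congr fun n => ?_
    simp [qf]
  have h := EulerProduct.eulerProduct_completely_multiplicative hs
  have e : (∑' n, qf n) = Real.pi ^ 2 / 6 := by
    rw [← hasSum_zeta_two.tsum_eq]; rfl
  rw [e] at h
  have hm : Monotone (fun n : ℕ ↦ ∏ p ∈ Nat.primesBelow n, (1 - qf p)⁻¹) := by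
    intro a b hab
    have hsub : Nat.primesBelow a ⊆ Nat.primesBelow b := by
      intro p hp
      rw [Nat.mem_primesBelow] at hp ⊢
      exact ⟨hp.1.trans_le hab, hp.2⟩
    have hone : ∀ p ∈ Nat.primesBelow b, (1 : ℝ) ≤ (1 - qf p)⁻¹ := by
      intro p hp
      have h1 := prime_sq_lt (Nat.mem_primesBelow.1 hp).2
      have h2 : (0 : ℝ) ≤ 1 / (p : ℝ) ^ 2 := by positivity
      have : qf p = 1 / (p : ℝ) ^ 2 := rfl
      rw [this]
      apply (one_le_inv₀ (by linarith)).2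
      linarith
    show ∏ p ∈ Nat.primesBelow a, (1 - qf p)⁻¹ ≤ ∏ p ∈ Nat.primesBelow b, (1 - qf p)⁻¹
    rw [← prod_sdiff hsub]
    apply le_mul_of_one_le_left
    · exact prod_nonneg fun p hp => zero_le_one.trans (hone p (hsub hp))
    · apply prod_induction _ (fun t : ℝ => 1 ≤ t) (fun u v hu hv => one_le_mul_of_one_le_of_one_le hu hv) le_rfl
      intro p hp
      exact hone p (mem_sdiff.1 hp).1
  exact hm.ge_of_tendsto h N

lemma qP_le_log (N : ℕ) : qP N ≤ Real.log (Real.pi ^ 2 / 6) := by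
  have e1 : qP N = ∑ m ∈ Ioc 0 ⌊(N : ℝ)⌋₊ with IsPrimePow m, qa m := by
    rw [Nat.floor_natCast, qP]
    symm
    apply sum_subset
    · intro m hm
      simp only [mem_filter, mem_Ioc, mem_range] at hm ⊢
      omega
    · intro m hm hm'
      simp only [mem_filter, mem_Ioc, mem_range] at hm hm'
      by_cases h0 : m = 0
      · simp [h0, qa]
      · have : ¬ IsPrimePow m := fun h => hm' ⟨⟨by omega, by omega⟩, h⟩
        simp [qa, vonMangoldt_apply, this]
  set K := ⌊Real.log (N : ℝ) / Real.log 2⌋₊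
  rw [e1, Chebyshev.sum_PrimePow_eq_sum_sum' qa (Nat.cast_nonneg N) (le_refl K)]
  have e2 : ∑ k ∈ Icc 1 K, ∑ p ∈ Ioc 0 ⌊(N : ℝ) ^ ((1 : ℝ) / k)⌋₊ with p.Prime, qa (p ^ k)
      ≤ ∑ k ∈ Icc 1 K, ∑ p ∈ Nat.primesBelow (N + 1), qa (p ^ k) := by
    apply sum_le_sum
    intro k hk
    apply sum_le_sum_of_subset_of_nonneg
    · intro p hp
      simp only [mem_filter, mem_Ioc, mem_Icc] at hp hk
      rw [Nat.mem_primesBelow]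
      refine ⟨?_, hp.2⟩
      have h1 : (p : ℝ) ≤ (N : ℝ) ^ ((1 : ℝ) / k) := (Nat.le_floor_iff (by positivity)).1 hp.1.2
      have hN : (1 : ℝ) ≤ N := by
        by_contra hcon
        have : N = 0 := by
          push Not at hcon
          have : N < 1 := by exact_mod_cast hcon
          omega
        rw [this] at h1
        have hk1 : (1 : ℝ) / k ≠ 0 := by
          have : (0 : ℝ) < k := by exact_mod_cast hk.1
          positivity
        rw [Nat.cast_zero, Real.zero_rpow hk1] at h1
        have := hp.2.pos
        have : (0 : ℝ) < p := by exact_mod_cast this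
        linarith
      have h2 : (N : ℝ) ^ ((1 : ℝ) / k) ≤ (N : ℝ) ^ (1 : ℝ) := by
        apply Real.rpow_le_rpow_of_exponent_le hN
        rw [div_le_one (by exact_mod_cast hk.1)]
        exact_mod_cast hk.1
      rw [Real.rpow_one] at h2
      have : p ≤ N := by exact_mod_cast h1.trans h2
      omega
    · intros; exact qa_nonneg _
  refine e2.trans ?_
  rw [sum_comm]
  have e3 : ∀ p ∈ Nat.primesBelow (N + 1), ∑ k ∈ Icc 1 K, qa (p ^ k)
      ≤ Real.log ((1 - (1 : ℝ) / (p : ℝ) ^ 2)⁻¹) := by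
    intro p hp
    have hp' := (Nat.mem_primesBelow.1 hp).2
    have hlt := prime_sq_lt hp'
    have h0 : (0 : ℝ) ≤ 1 / (p : ℝ) ^ 2 := by positivity
    rw [Real.log_inv]
    have hs := Real.hasSum_pow_div_log_of_abs_lt_one (x := (1 : ℝ) / (p : ℝ) ^ 2)
      (by rwa [abs_of_nonneg h0])
    have := sum_le_hasSum (range K) (fun i _ => by positivity) hs
    refine le_trans (le_of_eq ?_) this
    have hI : Icc 1 K = Ico (0 + 1) (K + 1) := by
      ext m; simp only [mem_Icc, mem_Ico]; omega
    rw [hI, ← sum_Ico_add' (fun k : ℕ => qa (p ^ k)) 0 K 1, range_eq_Ico]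
    apply sum_congr rfl
    intro k _
    rw [qa_prime_pow hp' (by omega)]
    push_cast
    rfl
  refine (sum_le_sum e3).trans ?_
  rw [← Real.log_prod]
  · apply Real.log_le_log
    · apply prod_pos
      intro p hp
      have := prime_sq_lt (Nat.mem_primesBelow.1 hp).2
      apply inv_pos.2; linarith
    · exact prod_le _
  · intro p hp
    have := prime_sq_lt (Nat.mem_primesBelow.1 hp).2
    apply inv_ne_zero; linarith

lemma log_zeta_le : Real.log (Real.pi ^ 2 / 6) ≤ 0.4977003025 := by
  rw [Real.log_le_iff_le_exp (by positivity)]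
  have h1 : Real.pi ^ 2 / 6 ≤ 1.64493406685 := by
    have := Real.pi_lt_d20
    have h0 := Real.pi_pos
    nlinarith
  refine h1.trans (le_trans ?_ (Real.sum_le_exp_of_nonneg (by norm_num) 14))
  norm_num [sum_range_succ, Nat.factorial]

lemma tail_le {y B : ℝ} (h : ∀ N, ∑ m ∈ range N, (if y < (m : ℝ) then qa m else 0) ≤ B) :
    (∑' m : ℕ, if y < (m : ℝ) then qa m else 0) ≤ B := by
  apply Real.tsum_le_of_sum_range_le _ h
  intro n
  split_ifs
  · exact qa_nonneg n
  · exact le_rfl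

lemma tail_le_zeta {y : ℝ} (hy : 0 ≤ y) :
    (∑' m : ℕ, if y < (m : ℝ) then qa m else 0) ≤ 0.4977003025 - qP ⌊y⌋₊ := by
  apply tail_le
  intro N
  have h1 := (qP_le_log (N + ⌊y⌋₊)).trans log_zeta_le
  suffices ∑ m ∈ range N, (if y < (m : ℝ) then qa m else 0) + qP ⌊y⌋₊ ≤ qP (N + ⌊y⌋₊) by linarith
  have h2 : ∑ m ∈ range N, (if y < (m : ℝ) then qa m else 0) ≤
      ∑ m ∈ range (N + ⌊y⌋₊ + 1), (if y < (m : ℝ) then qa m else 0) := by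
    apply sum_le_sum_of_subset_of_nonneg
    · intro m; simp only [mem_range]; omega
    · intro m _ _
      split_ifs
      · exact qa_nonneg m
      · exact le_rfl
  have h3 : qP ⌊y⌋₊ = ∑ m ∈ range (N + ⌊y⌋₊ + 1), (if y < (m : ℝ) then 0 else qa m) := by
    rw [qP]
    have : ∀ m ∈ range (⌊y⌋₊ + 1), qa m = if y < (m : ℝ) then 0 else qa m := by
      intro m hm
      rw [if_neg]
      rw [not_lt, ← Nat.le_floor_iff hy]
      have := mem_range.1 hm
      omega
    rw [sum_congr rfl this]
    apply sum_subset
    · intro m; simp only [mem_range]; omega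
    · intro m _ hm
      rw [if_pos]
      rw [← Nat.floor_lt hy]
      rw [mem_range] at hm
      omega
  rw [h3]
  refine (add_le_add_left h2 _).trans (le_of_eq ?_)
  rw [← sum_add_distrib, qP]
  apply sum_congr rfl
  intro m _
  split_ifs <;> simp

lemma psi_succ (m : ℕ) : Chebyshev.psi ((m + 1 : ℕ) : ℝ) = Chebyshev.psi (m : ℝ) + vonMangoldt (m + 1) := by
  unfold Chebyshev.psi
  rw [Nat.floor_natCast, Nat.floor_natCast, ← Finset.sum_Ioc_succ_top (Nat.zero_le m)]

lemma psi_large {m : ℕ} (hm : 8192 ≤ m) : Chebyshev.psi (m : ℝ) ≤ 1.586 * m := by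
  have hm' : (8192 : ℝ) ≤ m := by exact_mod_cast hm
  have h := Chebyshev.psi_le (x := (m : ℝ)) (by linarith)
  have he : Real.exp 2 ≤ 8192 := by
    have h1 := Real.exp_one_lt_d9
    have : Real.exp 2 = Real.exp 1 * Real.exp 1 := by rw [← Real.exp_add]; norm_num
    rw [this]
    nlinarith [Real.exp_pos 1]
  have ha := Real.log_div_sqrt_antitoneOn (a := 8192) (b := m) he (he.trans hm') hm'
  have hl2 := Real.log_two_lt_d9
  have hl : Real.log 8192 = 13 * Real.log 2 := by
    rw [show (8192 : ℝ) = 2 ^ 13 by norm_num, Real.log_pow]; norm_num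
  have hl4 : Real.log 4 = 2 * Real.log 2 := by
    rw [show (4 : ℝ) = 2 ^ 2 by norm_num, Real.log_pow]; norm_num
  have hs : (90.5 : ℝ) ≤ √8192 := Real.le_sqrt_of_sq_le (by norm_num)
  have h3 : Real.log 8192 / √8192 ≤ 0.0997 := by
    rw [div_le_iff₀ (by positivity), hl]
    nlinarith
  have hsm : 0 < √(m : ℝ) := Real.sqrt_pos.2 (by linarith)
  have h4 : Real.log m ≤ 0.0997 * √(m : ℝ) := by
    have := ha.trans h3
    rwa [div_le_iff₀ hsm] at this
  have h5 : √(m : ℝ) * √(m : ℝ) = m := Real.mul_self_sqrt (by linarith)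
  rw [hl4] at h
  nlinarith

/-- Telescoping majorant of the tail. -/
noncomputable def qu (m : ℕ) : ℝ :=
  2 * 1.586 / ((m : ℝ) + 1) - Chebyshev.psi (m : ℝ) / ((m : ℝ) + 1) ^ 2

lemma qu_nonneg {m : ℕ} (hm : 8192 ≤ m) : 0 ≤ qu m := by
  have h := psi_large hm
  unfold qu
  rw [sub_nonneg, div_le_div_iff₀ (by positivity) (by positivity)]
  have hm' : (0 : ℝ) ≤ m := by positivity
  nlinarith [mul_le_mul_of_nonneg_right h (by positivity : (0 : ℝ) ≤ (m : ℝ) + 1)]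

lemma qu_step {m : ℕ} (hm : 8192 ≤ m) :
    vonMangoldt (m + 1) / ((m : ℝ) + 1) ^ 2 ≤ qu m - qu (m + 1) := by
  have h := psi_large (m := m + 1) (by omega)
  unfold qu
  have hs := psi_succ m
  have hL : vonMangoldt (m + 1) = Chebyshev.psi ((m + 1 : ℕ) : ℝ) - Chebyshev.psi (m : ℝ) := by
    linarith
  rw [hL]
  push_cast at h ⊢
  set s := Chebyshev.psi ((m : ℝ) + 1)
  set t : ℝ := (m : ℝ) + 1
  have ht : 0 < t := by positivity
  suffices s * (1 / t ^ 2 - 1 / (t + 1) ^ 2) ≤ 2 * 1.586 * (1 / t - 1 / (t + 1)) by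
    have e1 : (s - Chebyshev.psi (m : ℝ)) / t ^ 2 = s * (1 / t ^ 2) - Chebyshev.psi (m : ℝ) / t ^ 2 := by ring
    have e2 : s / (t + 1) ^ 2 = s * (1 / (t + 1) ^ 2) := by ring
    have e3 : 2 * 1.586 / t = 2 * 1.586 * (1 / t) := by ring
    have e4 : 2 * 1.586 / (t + 1) = 2 * 1.586 * (1 / (t + 1)) := by ring
    rw [e1, e2, e3, e4]
    linarith
  have e1 : 1 / t ^ 2 - 1 / (t + 1) ^ 2 = (2 * t + 1) / (t ^ 2 * (t + 1) ^ 2) := by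
    field_simp; ring
  have e2 : 2 * 1.586 * (1 / t - 1 / (t + 1)) = (1.586 * t) * ((2 * t + 2) / (t ^ 2 * (t + 1) ^ 2)) := by
    field_simp; ring
  rw [e1, e2]
  have : 0 < t ^ 2 * (t + 1) ^ 2 := by positivity
  gcongr
  norm_num

lemma large_case {y : ℝ} (hy : 8192 ≤ y) :
    (∑' m : ℕ, if y < (m : ℝ) then qa m else 0) * y * Real.log y + Chebyshev.psi y / y
      ≤ 0.249 * Real.log y + 1 := by
  have hy0 : 0 ≤ y := by linarith
  have hypos : 0 < y := by linarith
  set n := ⌊y⌋₊ with hn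
  have hn1 : 8192 ≤ n := Nat.le_floor (by exact_mod_cast hy)
  have hny : (n : ℝ) ≤ y := Nat.floor_le hy0
  have hyn : y < n + 1 := Nat.lt_floor_add_one y
  have hlog2 := Real.log_two_gt_d9
  have hlogy : 9.01 ≤ Real.log y := by
    have hl : Real.log 8192 = 13 * Real.log 2 := by
      rw [show (8192 : ℝ) = 2 ^ 13 by norm_num, Real.log_pow]; norm_num
    have := Real.log_le_log (by norm_num) hy
    linarith
  have key : ∀ j : ℕ, ∑ m ∈ range (n + 1 + j), (if y < (m : ℝ) then qa m else 0)
      ≤ (qu n - qu (n + j)) / Real.log y := by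
    intro j
    induction j with
    | zero =>
      rw [sum_eq_zero]
      · simp
      · intro m hm
        rw [if_neg]
        rw [not_lt]
        have : m ≤ n := by have := mem_range.1 hm; omega
        exact le_trans (by exact_mod_cast this) hny
    | succ j ih =>
      rw [← add_assoc, sum_range_succ]
      have h1 := qu_step (m := n + j) (by omega)
      have hmy : y < ((n + 1 + j : ℕ) : ℝ) := by
        push_cast
        have : (0 : ℝ) ≤ j := by positivity
        linarith
      have h2 : qa (n + 1 + j) ≤ (qu (n + j) - qu (n + j + 1)) / Real.log y := by
        unfold qa
        have h3 : Real.log y ≤ Real.log ((n + 1 + j : ℕ) : ℝ) := Real.log_le_log hypos hmy.le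
        have h4 : vonMangoldt (n + 1 + j) / (((n + 1 + j : ℕ) : ℝ) ^ 2) ≤ qu (n + j) - qu (n + j + 1) := by
          convert! h1 using 2
          · congr 1; omega
          · push_cast; ring
        rw [← div_div]
        have h5 : 0 ≤ vonMangoldt (n + 1 + j) / (((n + 1 + j : ℕ) : ℝ) ^ 2) :=
          div_nonneg vonMangoldt_nonneg (by positivity)
        exact div_le_div₀ (h5.trans h4) h4 (by linarith) h3
      rw [if_pos hmy]
      refine (add_le_add ih h2).trans (le_of_eq ?_)
      rw [← add_div]
      congr 1
      ring_nf
  have hT : (∑' m : ℕ, if y < (m : ℝ) then qa m else 0) ≤ qu n / Real.log y := by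
    apply tail_le
    intro N
    have h1 : ∑ m ∈ range N, (if y < (m : ℝ) then qa m else 0) ≤
        ∑ m ∈ range (n + 1 + N), (if y < (m : ℝ) then qa m else 0) := by
      apply sum_le_sum_of_subset_of_nonneg
      · intro m; simp only [mem_range]; omega
      · intro m _ _
        split_ifs
        · exact qa_nonneg m
        · exact le_rfl
    refine h1.trans ((key N).trans ?_)
    have := qu_nonneg (m := n + N) (by omega)
    gcongr
    linarith
  have hpsi : Chebyshev.psi y = Chebyshev.psi (n : ℝ) := Chebyshev.psi_eq_psi_coe_floor y
  have h6 : (∑' m : ℕ, if y < (m : ℝ) then qa m else 0) * y * Real.log y ≤ qu n * y := by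
    have : 0 < Real.log y := by linarith
    rw [le_div_iff₀ this] at hT
    nlinarith
  have h7 : qu n * y + Chebyshev.psi (n : ℝ) / y ≤ 2 * 1.586 := by
    have hp := (psi_large hn1)
    unfold qu
    set s := Chebyshev.psi (n : ℝ)
    set t : ℝ := (n : ℝ) + 1
    have ht : 0 < t := by positivity
    have e : (2 * 1.586 / t - s / t ^ 2) * y + s / y
        = 2 * 1.586 * (y / t) + (s / y) * (1 - (y / t) ^ 2) := by
      field_simp
      ring
    rw [e]
    have hr : y / t ≤ 1 := by rw [div_le_one ht]; exact hyn.le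
    have hr0 : 0 ≤ y / t := by positivity
    have hsy : s / y ≤ 1.586 := by
      rw [div_le_iff₀ hypos]; nlinarith
    set r := y / t
    have : (s / y) * (1 - r ^ 2) ≤ 1.586 * (1 - r ^ 2) := by
      apply mul_le_mul_of_nonneg_right hsy
      nlinarith
    nlinarith [sq_nonneg (1 - r)]
  rw [hpsi]
  linarith

/-- Evaluate the argument to a literal before passing it on. -/
def frc {α : Type} (a : ℕ) (f : ℕ → α) : α := Nat.casesOn a (f 0) (fun k => f (k + 1))

lemma frc_eq {α : Type} (a : ℕ) (f : ℕ → α) : frc a f = f a := by cases a <;> rfl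

/-- Search for `k` with `q ^ k = m`, starting from `pw = q ^ k`; `0` if not found. -/
def fk (q m : ℕ) : ℕ → ℕ → ℕ → ℕ
  | 0, _, _ => 0
  | fuel + 1, k, pw => if Nat.beq pw m then k else fk q m fuel (k + 1) (pw * q)

lemma fk_spec (q m : ℕ) : ∀ fuel k pw, pw = q ^ k → fk q m fuel k pw ≠ 0 →
    q ^ (fk q m fuel k pw) = m
  | 0, _, _, _, h => absurd rfl h
  | fuel + 1, k, pw, hp, h => by
    unfold fk at h ⊢
    split_ifs at h ⊢ with hc
    · rw [← hp]; exact Nat.eq_of_beq_eq_true hc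
    · exact fk_spec q m fuel (k + 1) (pw * q) (by rw [hp, pow_succ]) h

/-- Lower bound for `10^15 * qa m` when `Λ(m) = log q`. -/
def trm (q m : ℕ) : ℕ :=
  if Nat.ble q 1 then 0 else 1000000000000000 / (fk q m 14 1 q * (m * m))

/-- Step through the integers, tracking the lcm and the partial sums. -/
def lop (f : ℕ → ℕ → ℕ → Bool) : ℕ → ℕ → ℕ → ℕ → Bool
  | 0, n, l, s => f n l s
  | fuel + 1, n, l, s =>
    frc (n + 1) fun m => frc (l * m / Nat.gcd l m) fun l' => frc (s + trm (l' / l) m) fun s' =>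
      lop f fuel m l' s'

/-- The loop invariant. -/
def qInv (n l s : ℕ) : Prop := l = Nat.lcmUpto n ∧ (s : ℝ) / 1000000000000000 ≤ qP n

lemma trm_le {q m : ℕ} (h : vonMangoldt m = Real.log q) :
    (trm q m : ℝ) / 1000000000000000 ≤ qa m := by
  unfold trm
  split_ifs with hq
  · simpa using qa_nonneg m
  have hq1 : 1 < q := by
    by_contra hc
    exact hq (by rw [Nat.ble_eq]; omega)
  by_cases hk : fk q m 14 1 q = 0
  · simpa [hk] using qa_nonneg m
  have hkm := fk_spec q m 14 1 q (by simp) hk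
  set k := fk q m 14 1 q
  have hl : 0 < Real.log q := Real.log_pos (by exact_mod_cast hq1)
  have hk0 : (0 : ℝ) < k := by exact_mod_cast Nat.pos_of_ne_zero hk
  have hm0 : (0 : ℝ) < m := by
    rw [← hkm]; push_cast
    have : (0 : ℝ) < q := by exact_mod_cast (by omega : 0 < q)
    positivity
  have e : qa m = 1 / (k * (m * m)) := by
    unfold qa
    rw [h]
    have : Real.log m = k * Real.log q := by
      rw [← hkm]; push_cast; rw [Real.log_pow]
    rw [this]
    field_simp
  rw [e]
  have := Nat.cast_div_le (α := ℝ) (m := 1000000000000000) (n := k * (m * m))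
  rw [div_le_iff₀ (by positivity)]
  refine this.trans (le_of_eq ?_)
  push_cast
  ring

lemma lcmUpto_succ (n : ℕ) : Nat.lcmUpto (n + 1) = Nat.lcm (Nat.lcmUpto n) (n + 1) := by
  unfold Nat.lcmUpto
  rw [← Finset.insert_Icc_right_eq_Icc_add_one (by omega), Finset.lcm_insert]
  simp only [id]
  exact Nat.lcm_comm _ _

lemma qInv_succ {n l s : ℕ} (h : qInv n l s) :
    qInv (n + 1) (l * (n + 1) / Nat.gcd l (n + 1))
      (s + trm ((l * (n + 1) / Nat.gcd l (n + 1)) / l) (n + 1)) := by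
  obtain ⟨h1, h2⟩ := h
  have hl : l * (n + 1) / Nat.gcd l (n + 1) = Nat.lcmUpto (n + 1) := by
    rw [lcmUpto_succ, ← h1]; rfl
  rw [hl]
  refine ⟨rfl, ?_⟩
  have hdvd : l ∣ Nat.lcmUpto (n + 1) := by
    rw [lcmUpto_succ, ← h1]; exact Nat.dvd_lcm_left _ _
  have hl0 : l ≠ 0 := h1 ▸ Nat.lcmUpto_ne_zero n
  have hL : vonMangoldt (n + 1) = Real.log ((Nat.lcmUpto (n + 1) / l : ℕ) : ℝ) := by
    rw [Nat.cast_div hdvd (by exact_mod_cast hl0), Real.log_div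
      (by exact_mod_cast Nat.lcmUpto_ne_zero _) (by exact_mod_cast hl0), h1,
      ← Chebyshev.psi_eq_log_lcmUpto, ← Chebyshev.psi_eq_log_lcmUpto, psi_succ]
    ring
  have := trm_le hL
  have e : qP (n + 1) = qP n + qa (n + 1) := by unfold qP; rw [sum_range_succ]
  rw [e]
  push_cast
  rw [add_div]
  linarith

lemma lop_spec (f : ℕ → ℕ → ℕ → Bool) : ∀ fuel n l s, qInv n l s → lop f fuel n l s = true →
    ∃ l' s', qInv (n + fuel) l' s' ∧ f (n + fuel) l' s' = true
  | 0, n, l, s, h, hf => ⟨l, s, h, hf⟩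
  | fuel + 1, n, l, s, h, hf => by
    simp only [lop, frc_eq] at hf
    have := lop_spec f fuel _ _ _ (qInv_succ h) hf
    rwa [show n + 1 + fuel = n + (fuel + 1) by omega] at this

/-- The inequality to check at the endpoint `e`, with `log e` replaced by
`V * h / (16384 * 10 ^ 10)`. -/
def ept (e V kl K τ h : ℕ) : Bool :=
  Nat.ble (1000 * K * 6931471808 * 16384 * 1000000000000000 + 1000 * (e * e) * τ * V * h * kl)
    (249 * V * h * kl * e * 1000000000000000
      + 1000 * 16384 * kl * 10000000000 * e * 1000000000000000)

/-- `V = ⌊log₂ (e ^ 16384)⌋`. -/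
def lgc (e V : ℕ) : Bool := Nat.ble (2 ^ V) (e ^ 16384) && Nat.ble (e ^ 16384) (2 ^ (V + 1))

/-- Full check at an endpoint. -/
def epts (e V kl K τ : ℕ) : Bool := ept e V kl K τ 6931471803 && ept e (V + 1) kl K τ 6931471808

/-- Check a list of consecutive intervals. -/
def chk : List (ℕ × ℕ × ℕ × ℕ) → ℕ → ℕ → ℕ → ℕ → Bool
  | [], a, _, _, _ => Nat.beq a 8192
  | (b, V, kl, K) :: rest, a, Va, l, s =>
    lop (fun n l' s' =>
      Nat.beq (n + 1) b && Nat.ble 1 kl && lgc b V && Nat.ble (l' ^ kl) (2 ^ K) &&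
      frc (497700302500000 - s) (fun τ => epts a Va kl K τ && epts b V kl K τ) &&
      lop (fun _ l'' s'' => chk rest b V l'' s'') 1 n l' s') (b - 1 - a) a l s

lemma lgc_spec {e V : ℕ} (he : 1 ≤ e) (h : lgc e V = true) :
    (V : ℝ) * 6931471803 / (16384 * 10000000000) ≤ Real.log e ∧
    Real.log e ≤ ((V + 1 : ℕ) : ℝ) * 6931471808 / (16384 * 10000000000) := by
  have h1 := Real.log_two_gt_d9
  have h2 := Real.log_two_lt_d9
  rw [lgc, Bool.and_eq_true, Nat.ble_eq, Nat.ble_eq] at h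
  obtain ⟨ha, hb⟩ := h
  have he' : (0 : ℝ) < e := by exact_mod_cast he
  have ha' : (2 : ℝ) ^ V ≤ (e : ℝ) ^ 16384 := by exact_mod_cast ha
  have hb' : (e : ℝ) ^ 16384 ≤ (2 : ℝ) ^ (V + 1) := by exact_mod_cast hb
  have ha2 := Real.log_le_log (by positivity) ha'
  have hb2 := Real.log_le_log (by positivity) hb'
  rw [Real.log_pow, Real.log_pow] at ha2 hb2
  have hV : (0 : ℝ) ≤ V := by positivity
  have hV1 : (0 : ℝ) ≤ ((V + 1 : ℕ) : ℝ) := by positivity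
  constructor
  · rw [div_le_iff₀ (by norm_num)]
    have := mul_le_mul_of_nonneg_left h1.le hV
    push_cast at ha2
    linarith
  · rw [le_div_iff₀ (by norm_num)]
    have := mul_le_mul_of_nonneg_left h2.le hV1
    push_cast at hb2 this ⊢
    linarith

lemma ept_spec {e V kl K τ h : ℕ} (he : 1 ≤ e) (hk : 1 ≤ kl) (ht : ept e V kl K τ h = true) :
    (τ : ℝ) / 1000000000000000 * e * ((V : ℝ) * h / (16384 * 10000000000)) +
      ((K : ℝ) * 6931471808 / (kl * 10000000000)) / e
      ≤ 0.249 * ((V : ℝ) * h / (16384 * 10000000000)) + 1 := by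
  rw [ept, Nat.ble_eq] at ht
  have ht' : (1000 * K * 6931471808 * 16384 * 1000000000000000
      + 1000 * (e * e) * τ * V * h * kl : ℝ) ≤
      249 * V * h * kl * e * 1000000000000000
      + 1000 * 16384 * kl * 10000000000 * e * 1000000000000000 := by exact_mod_cast ht
  have he' : (0 : ℝ) < e := by exact_mod_cast he
  have hk' : (0 : ℝ) < kl := by exact_mod_cast hk
  have hM : (0 : ℝ) < 1000 * 16384 * kl * 10000000000 * e * 1000000000000000 := by positivity
  rw [← mul_le_mul_iff_left₀ hM]
  calc _ = (1000 * K * 6931471808 * 16384 * 1000000000000000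
      + 1000 * (e * e) * τ * V * h * kl : ℝ) := by field_simp; ring
    _ ≤ _ := ht'
    _ = _ := by field_simp; ring

lemma lin_between {p q r c v v1 v2 : ℝ} (h1 : v1 ≤ v) (h2 : v ≤ v2)
    (e1 : p * v1 + r ≤ q * v1 + c) (e2 : p * v2 + r ≤ q * v2 + c) : p * v + r ≤ q * v + c := by
  rcases le_total p q with h | h
  · nlinarith [mul_nonneg (sub_nonneg.2 h) (sub_nonneg.2 h1)]
  · nlinarith [mul_nonneg (sub_nonneg.2 h) (sub_nonneg.2 h2)]

lemma epts_spec {e V kl K τ : ℕ} (he : 1 ≤ e) (hk : 1 ≤ kl) (hl : lgc e V = true)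
    (ht : epts e V kl K τ = true) :
    (τ : ℝ) / 1000000000000000 * e * Real.log e +
      ((K : ℝ) * 6931471808 / (kl * 10000000000)) / e ≤ 0.249 * Real.log e + 1 := by
  rw [epts, Bool.and_eq_true] at ht
  have h1 := ept_spec he hk ht.1
  have h2 := ept_spec he hk ht.2
  obtain ⟨l1, l2⟩ := lgc_spec he hl
  exact lin_between l1 l2 (by exact_mod_cast h1) (by exact_mod_cast h2)

lemma concave_H {t w : ℝ} (ht : 0 ≤ t) (hw : 0 ≤ w) :
    ConvexOn ℝ (Set.Ioi 0) (fun y : ℝ => t * (y * Real.log y) + w * y⁻¹ + 0.249 * (-Real.log y)) := by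
  have h1 : ConvexOn ℝ (Set.Ioi 0) (fun y : ℝ => y * Real.log y) :=
    Real.convexOn_mul_log.subset Set.Ioi_subset_Ici_self (convex_Ioi 0)
  have h2 : ConvexOn ℝ (Set.Ioi 0) (fun y : ℝ => y⁻¹) := by
    simpa using convexOn_zpow (𝕜 := ℝ) (-1)
  have h3 : ConvexOn ℝ (Set.Ioi 0) (fun y : ℝ => -Real.log y) :=
    strictConcaveOn_log_Ioi.concaveOn.neg
  exact ((h1.smul ht).add (h2.smul hw)).add (h3.smul (by norm_num : (0 : ℝ) ≤ 0.249))

lemma interval_case {t w a b y : ℝ} (ht : 0 ≤ t) (hw : 0 ≤ w) (ha : 0 < a) (hay : a ≤ y)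
    (hyb : y ≤ b) (h1 : t * a * Real.log a + w / a ≤ 0.249 * Real.log a + 1)
    (h2 : t * b * Real.log b + w / b ≤ 0.249 * Real.log b + 1) :
    t * y * Real.log y + w / y ≤ 0.249 * Real.log y + 1 := by
  have h := (concave_H ht hw).le_max_of_mem_Icc (x := a) (y := b) (z := y) ha
    (show (0 : ℝ) < b by linarith) ⟨hay, hyb⟩
  have hmax : max (t * (a * Real.log a) + w * a⁻¹ + 0.249 * (-Real.log a))
      (t * (b * Real.log b) + w * b⁻¹ + 0.249 * (-Real.log b)) ≤ 1 := by
    apply max_le <;> simp only [div_eq_mul_inv] at h1 h2 <;> linarith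
  have := h.trans hmax
  rw [div_eq_mul_inv]
  linarith

lemma qP_mono {m n : ℕ} (h : m ≤ n) : qP m ≤ qP n := by
  unfold qP
  apply sum_le_sum_of_subset_of_nonneg
  · intro i; simp only [mem_range]; omega
  · intros; exact qa_nonneg _

lemma chk_spec : ∀ (L : List (ℕ × ℕ × ℕ × ℕ)) (a Va l s : ℕ), 1 ≤ a → lgc a Va = true →
    qInv a l s → chk L a Va l s = true → ∀ y : ℝ, (a : ℝ) ≤ y → y < 8192 →
    (∑' m : ℕ, if y < (m : ℝ) then qa m else 0) * y * Real.log y + Chebyshev.psi y / y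
      ≤ 0.249 * Real.log y + 1
  | [], a, Va, l, s, ha, hV, hI, hc, y, hay, hy => by
    rw [chk] at hc
    have : a = 8192 := Nat.eq_of_beq_eq_true hc
    subst this
    norm_num at hay
    linarith
  | (b, V, kl, K) :: rest, a, Va, l, s, ha, hV, hI, hc, y, hay, hy => by
    rw [chk] at hc
    obtain ⟨l', s', hI', hf⟩ := lop_spec _ _ _ _ _ hI hc
    simp only [Bool.and_eq_true, frc_eq, Nat.ble_eq] at hf
    obtain ⟨⟨⟨⟨⟨hb, hk⟩, hVb⟩, hlK⟩, hea, heb⟩, hrest⟩ := hf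
    have hb' := Nat.eq_of_beq_eq_true hb
    obtain ⟨l'', s'', hI'', hf''⟩ := lop_spec _ _ _ _ _ hI' hrest
    have hb1 : 1 ≤ b := by omega
    rcases le_or_gt (b : ℝ) y with hby | hyb
    · rw [hb'] at hI''
      exact chk_spec rest b V l'' s'' hb1 hVb hI'' hf'' y hby hy
    have ha' : (0 : ℝ) < a := by exact_mod_cast ha
    have hy0 : 0 < y := by linarith
    have hT := tail_le_zeta hy0.le
    have haf : a ≤ ⌊y⌋₊ := Nat.le_floor hay
    have hP := qP_mono haf
    set w : ℝ := (K : ℝ) * 6931471808 / (kl * 10000000000) with hw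
    set t : ℝ := ((497700302500000 - s : ℕ) : ℝ) / 1000000000000000 with ht
    have hk' : (0 : ℝ) < kl := by exact_mod_cast hk
    have h := interval_case (t := t) (w := w) (a := a) (b := b) (y := y) (by positivity)
      (by positivity) ha' hay hyb.le (epts_spec ha hk hV hea) (epts_spec hb1 hk hVb heb)
    have hts : 0.4977003025 - (s : ℝ) / 1000000000000000 ≤ t := by
      have : (497700302500000 : ℝ) ≤ ((497700302500000 - s : ℕ) : ℝ) + s := by
        exact_mod_cast (by omega : 497700302500000 ≤ (497700302500000 - s) + s)
      rw [ht, sub_le_iff_le_add, ← add_div, le_div_iff₀ (by norm_num)]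
      linarith
    have hTt : (∑' m : ℕ, if y < (m : ℝ) then qa m else 0) ≤ t := by
      have := hI.2
      linarith
    have hpsi : Chebyshev.psi y ≤ w := by
      have hle : Chebyshev.psi y ≤ Chebyshev.psi ((b - 1 : ℕ) : ℝ) := by
        rw [Chebyshev.psi_eq_psi_coe_floor y]
        apply Chebyshev.psi_mono
        have : ⌊y⌋₊ < b := (Nat.floor_lt hy0.le).2 hyb
        exact_mod_cast (by omega : ⌊y⌋₊ ≤ b - 1)
      refine hle.trans ?_
      have hbb : a + (b - 1 - a) = b - 1 := by omega
      rw [Chebyshev.psi_eq_log_lcmUpto, ← hbb, ← hI'.1]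
      have hl0 : l' ≠ 0 := hI'.1 ▸ Nat.lcmUpto_ne_zero _
      have hl0' : (0 : ℝ) < l' := by exact_mod_cast Nat.pos_of_ne_zero hl0
      have h1 : (l' : ℝ) ^ kl ≤ 2 ^ K := by exact_mod_cast hlK
      have h2 := Real.log_le_log (by positivity) h1
      rw [Real.log_pow, Real.log_pow] at h2
      have h3 := mul_le_mul_of_nonneg_left Real.log_two_lt_d9.le (Nat.cast_nonneg (α := ℝ) K)
      rw [hw, le_div_iff₀ (by positivity)]
      linarith
    have hly : 0 ≤ Real.log y := by
      apply Real.log_nonneg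
      have : (1 : ℝ) ≤ a := by exact_mod_cast ha
      linarith
    refine le_trans ?_ h
    gcongr

/-- Certificates for the intervals between consecutive breakpoints. -/
def certs : List (ℕ × ℕ × ℕ × ℕ) :=
  [(11, 56679, 16384, 185127),
   (13, 60628, 16384, 241806),
   (16, 65536, 16384, 302434),
   (17, 66968, 16384, 318818),
   (19, 69598, 16384, 385787),
   (23, 74114, 16384, 455385),
   (25, 76084, 16384, 529499),
   (29, 79593, 16384, 593510),
   (31, 81169, 16384, 673103),
   (37, 85351, 16384, 770656),
   (43, 88903, 64, 3687),
   (53, 93846, 64, 4570),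
   (67, 99386, 64, 5756),
   (83, 104448, 64, 7439),
   (107, 110452, 64, 9538),
   (139, 116636, 64, 12625),
   (193, 124394, 64, 17572),
   (281, 133274, 64, 25801),
   (433, 143494, 64, 39517),
   (701, 154882, 4, 4034),
   (1223, 168037, 4, 7009),
   (2281, 182770, 4, 13106),
   (4591, 199304, 4, 26430),
   (8192, 212992, 4, 47184)]

set_option maxRecDepth 100000 in
lemma chk_all : (lgc 9 51936 && lop (fun n l s => chk certs n 51936 l s) 9 0 1 0) = true := by
  decide +kernel

lemma small_case {y : ℝ} (h9 : 9 ≤ y) (hy : y < 8192) :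
    (∑' m : ℕ, if y < (m : ℝ) then qa m else 0) * y * Real.log y + Chebyshev.psi y / y
      ≤ 0.249 * Real.log y + 1 := by
  have h := chk_all
  rw [Bool.and_eq_true] at h
  have h0 : qInv 0 1 0 := by
    refine ⟨by simp [Nat.lcmUpto], ?_⟩
    simp [qP, qa]
  obtain ⟨l, s, hI, hc⟩ := lop_spec _ _ _ _ _ h0 h.2
  exact chk_spec certs 9 _ l s (by norm_num) h.1 hI hc y (by exact_mod_cast h9) hy

open scoped Classical in
/-- Assuming the Riemann hypothesis, with
`Q(x) = Σ_{m>√x} Λ(m)/(m² log m) + (2/(x log x)) Σ_{m≤√x} Λ(m)`, for all real `x ≥ 81`,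
`Q(x) ≤ (0.249 + 2/log x)/√x`. -/
theorem Q_bound (RH : RiemannHypothesis) (x : ℝ) (hx : 81 ≤ x) :
    (∑' m : ℕ, if Real.sqrt x < (m : ℝ) then
        ArithmeticFunction.vonMangoldt m / ((m : ℝ) ^ 2 * Real.log m) else 0)
      + (2 / (x * Real.log x)) *
          ∑ m ∈ Finset.Icc 1 ⌊Real.sqrt x⌋₊, ArithmeticFunction.vonMangoldt m
      ≤ (0.249 + 2 / Real.log x) / Real.sqrt x := by
  set y := Real.sqrt x with hy
  have hx0 : 0 ≤ x := by linarith
  have hyx : y ^ 2 = x := Real.sq_sqrt hx0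
  have hy9 : 9 ≤ y := Real.le_sqrt_of_sq_le (by norm_num; linarith)
  have hlx : Real.log x = 2 * Real.log y := by
    rw [← hyx, Real.log_pow]; norm_num
  have hly : 0 < Real.log y := Real.log_pos (by linarith)
  have main : (∑' m : ℕ, if y < (m : ℝ) then qa m else 0) * y * Real.log y + Chebyshev.psi y / y
      ≤ 0.249 * Real.log y + 1 := by
    rcases lt_or_ge y 8192 with h | h
    · exact small_case hy9 h
    · exact large_case h
  have hT : (∑' m : ℕ, if y < (m : ℝ) then
        ArithmeticFunction.vonMangoldt m / ((m : ℝ) ^ 2 * Real.log m) else 0)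
      = ∑' m : ℕ, if y < (m : ℝ) then qa m else 0 := by
    apply tsum_congr
    intro m
    split_ifs <;> rfl
  have hpsi : ∑ m ∈ Finset.Icc 1 ⌊y⌋₊, ArithmeticFunction.vonMangoldt m = Chebyshev.psi y := by
    unfold Chebyshev.psi
    rfl
  rw [hT, hpsi, hlx, ← hyx]
  have hy0 : 0 < y := by linarith
  set T := ∑' m : ℕ, if y < (m : ℝ) then qa m else 0
  have e1 : T + 2 / (y ^ 2 * (2 * Real.log y)) * Chebyshev.psi y
      = (T * y * Real.log y + Chebyshev.psi y / y) / (y * Real.log y) := by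
    field_simp
  have e2 : (0.249 + 2 / (2 * Real.log y)) / y
      = (0.249 * Real.log y + 1) / (y * Real.log y) := by
    field_simp
  rw [e1, e2]
  gcongr
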